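/- Let G be a group acting by isometries on a metric space X, let x ∈ X and D > 0, and suppose that the set S = {g ∈ G : d(x, g•x) ≤ 2D + 2} is finite, with cardinality N. Then for every τ ≥ 0 and every 1-Lipschitz map γ: [0, τ] → X, the set {b ∈ G : there exists t ∈ [0, τ] with d(b•x, γ(t)) ≤ D} is finite, with cardinality at most N·(τ + 1). -/

import Mathlib

/-- If an orbit map sends `B` into a set of diameter at most `R`, then `B` is contained in a
translate of `{g | d(x, g • x) ≤ R}`. -/
theorem finite_and_ncard_le_of_dist_smul_le {G X : Type*} [Group G] [MetricSpace X]
    [MulAction G X] (hiso : ∀ (g : G) (a b : X), dist (g • a) (g • b) = dist a b)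
    {x : X} {R : ℝ} (hfin : {g : G | dist x (g • x) ≤ R}.Finite) {B : Set G}
    (hB : ∀ b ∈ B, ∀ c ∈ B, dist (b • x) (c • x) ≤ R) :
    B.Finite ∧ B.ncard ≤ {g : G | dist x (g • x) ≤ R}.ncard := by
  rcases B.eq_empty_or_nonempty with rfl | ⟨b, hb⟩
  · simp
  have hsub : B ⊆ (fun g => b * g) '' {g : G | dist x (g • x) ≤ R} := by
    intro c hc
    refine ⟨b⁻¹ * c, ?_, mul_inv_cancel_left b c⟩
    rw [Set.mem_ofPred_eq, ← hiso b, smul_smul, mul_inv_cancel_left]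
    exact hB b hb c hc
  exact ⟨(hfin.image _).subset hsub,
    (Set.ncard_le_ncard hsub (hfin.image _)).trans (Set.ncard_image_le hfin)⟩

/-- Let `G` act by isometries on a metric space `X`, let `x ∈ X`, `D > 0`, and suppose
the set `{g | d(x, g • x) ≤ 2D + 2}` is finite with cardinality `N`. Then for every
`τ ≥ 0` and every `1`-Lipschitz path `γ : [0, τ] → X`, the set of `b ∈ G` whose orbit
point `b • x` lies within distance `D` of the path is finite of cardinality at most
`N * (τ + 1)`. -/
theorem orbit_points_near_path_finite {G X : Type*} [Group G] [MetricSpace X]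
    [MulAction G X]
    (hiso : ∀ (g : G) (a b : X), dist (g • a) (g • b) = dist a b)
    (x : X) (D : ℝ) (hD : 0 < D) (N : ℕ)
    (hfin : {g : G | dist x (g • x) ≤ 2 * D + 2}.Finite)
    (hN : {g : G | dist x (g • x) ≤ 2 * D + 2}.ncard = N)
    (τ : ℝ) (hτ : 0 ≤ τ) (γ : ℝ → X)
    (hγ : LipschitzOnWith 1 γ (Set.Icc 0 τ)) :
    {b : G | ∃ t ∈ Set.Icc (0 : ℝ) τ, dist (b • x) (γ t) ≤ D}.Finite ∧
      ({b : G | ∃ t ∈ Set.Icc (0 : ℝ) τ, dist (b • x) (γ t) ≤ D}.ncard : ℝ) ≤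
        (N : ℝ) * (τ + 1) := by
  let B : ℕ → Set G := fun k =>
    {b | ∃ t ∈ Set.Icc (0 : ℝ) τ, ⌊t⌋₊ = k ∧ dist (b • x) (γ t) ≤ D}
  have hB : ∀ k, (B k).Finite ∧ (B k).ncard ≤ N := by
    intro k
    rw [← hN]
    refine finite_and_ncard_le_of_dist_smul_le hiso hfin ?_
    rintro b ⟨t, ht, htk, hbt⟩ c ⟨s, hs, hsk, hcs⟩
    have hts : dist (γ t) (γ s) ≤ dist t s := by
      simpa using hγ.dist_le_mul t ht s hs
    have hdist : dist t s ≤ 1 := by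
      rw [Nat.floor_eq_iff ht.1] at htk
      rw [Nat.floor_eq_iff hs.1] at hsk
      rw [Real.dist_eq, abs_le]
      constructor <;> linarith [htk.1, htk.2, hsk.1, hsk.2]
    have htri := dist_triangle4 (b • x) (γ t) (γ s) (c • x)
    rw [dist_comm (γ s)] at htri
    linarith
  have hsub : {b : G | ∃ t ∈ Set.Icc (0 : ℝ) τ, dist (b • x) (γ t) ≤ D} ⊆
      ⋃ k ∈ Finset.range (⌊τ⌋₊ + 1), B k := by
    rintro b ⟨t, ht, hbt⟩
    exact Set.mem_biUnion
      (Finset.mem_coe.2 (Finset.mem_range.2 (Nat.lt_succ_of_le (Nat.floor_le_floor ht.2))))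
      ⟨t, ht, rfl, hbt⟩
  have hfinU : (⋃ k ∈ Finset.range (⌊τ⌋₊ + 1), B k).Finite :=
    (Finset.range (⌊τ⌋₊ + 1)).finite_toSet.biUnion fun k _ => (hB k).1
  refine ⟨hfinU.subset hsub, ?_⟩
  have hcard : {b : G | ∃ t ∈ Set.Icc (0 : ℝ) τ, dist (b • x) (γ t) ≤ D}.ncard ≤
      N * (⌊τ⌋₊ + 1) :=
    calc
      _ ≤ (⋃ k ∈ Finset.range (⌊τ⌋₊ + 1), B k).ncard := Set.ncard_le_ncard hsub hfinU
      _ ≤ ∑ k ∈ Finset.range (⌊τ⌋₊ + 1), (B k).ncard := Finset.set_ncard_biUnion_le _ _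
      _ ≤ ∑ _k ∈ Finset.range (⌊τ⌋₊ + 1), N := Finset.sum_le_sum fun k _ => (hB k).2
      _ = N * (⌊τ⌋₊ + 1) := by simp [mul_comm]
  calc
    _ ≤ ((N * (⌊τ⌋₊ + 1) : ℕ) : ℝ) := Nat.cast_le.2 hcard
    _ = (N : ℝ) * (⌊τ⌋₊ + 1) := by push_cast; ring
    _ ≤ (N : ℝ) * (τ + 1) := by
      gcongr
      exact Nat.floor_le hτ
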